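/- arXiv:2011.00276 — 2 statements merged into one kernel-verified Lean document; each statement's English description precedes it below -/
import Mathlib

section
/- Doubling identity between the line and the half-line: let p ∈ (2,6), α > 0 and μ ∈ (0, μ_{ℝ⁺}). Then ℰ_α(2μ, ℝ) = 2 ℰ_α(μ, ℝ⁺), where ℰ_α(2μ, ℝ) is the infimum of the NLS energy over H¹_{2μ}(ℝ) and ℰ_α(μ, ℝ⁺) is the infimum of the NLS energy over H¹_μ(ℝ⁺). -/
open MeasureTheory Real Set Filter

/-- Membership in `H¹(ℝ)`: `u` is differentiable with derivative `u'`,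
and both `u` and `u'` are square-integrable on `ℝ`. -/
def H1line (u u' : ℝ → ℝ) : Prop :=
  (∀ x, HasDerivAt u (u' x) x) ∧
  Integrable (fun x => (u x) ^ 2) ∧
  Integrable (fun x => (u' x) ^ 2)

/-- The NLS energy with combined nonlinearities on the line. -/
noncomputable def Eline (p α : ℝ) (u u' : ℝ → ℝ) : ℝ :=
  ∫ x, (1 / 2 * (u' x) ^ 2 - 1 / 6 * |u x| ^ 6 - α / p * |u x| ^ p)

/-- The ground state energy level `ℰ_α(μ, ℝ)`. -/
noncomputable def glevelLine (p α μ : ℝ) : ℝ :=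
  sInf {e : ℝ | ∃ u u' : ℝ → ℝ, H1line u u' ∧ (∫ x, (u x) ^ 2) = μ ∧ Eline p α u u' = e}

/-- Membership in `H¹(ℝ⁺)`: `u` is continuous on `[0,∞)`, differentiable on `(0,∞)`
with derivative `u'`, and both `u` and `u'` are square-integrable on `(0,∞)`. -/
def H1halfline (u u' : ℝ → ℝ) : Prop :=
  ContinuousOn u (Set.Ici 0) ∧
  (∀ x ∈ Set.Ioi (0 : ℝ), HasDerivAt u (u' x) x) ∧
  IntegrableOn (fun x => (u x) ^ 2) (Set.Ioi 0) ∧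
  IntegrableOn (fun x => (u' x) ^ 2) (Set.Ioi 0)

/-- The NLS energy with combined nonlinearities on the half-line. -/
noncomputable def Ehalfline (p α : ℝ) (u u' : ℝ → ℝ) : ℝ :=
  ∫ x in Set.Ioi (0 : ℝ),
    (1 / 2 * (u' x) ^ 2 - 1 / 6 * |u x| ^ 6 - α / p * |u x| ^ p)

/-- The ground state energy level `ℰ_α(μ, ℝ⁺)`. -/
noncomputable def glevelHalfline (p α μ : ℝ) : ℝ :=
  sInf {e : ℝ | ∃ u u' : ℝ → ℝ, H1halfline u u' ∧
    (∫ x in Set.Ioi (0 : ℝ), (u x) ^ 2) = μ ∧ Ehalfline p α u u' = e}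

lemma sInf_eq_two_mul_sInf {A B : Set ℝ} (hAB : ∀ a ∈ A, ∃ b ∈ B, 2 * b ≤ a)
    (hBA : ∀ b ∈ B, ∀ ε > 0, ∃ a ∈ A, a ≤ 2 * b + ε) : sInf A = 2 * sInf B := by
  rcases B.eq_empty_or_nonempty with rfl | hB
  · have : A = ∅ := by
      by_contra h
      obtain ⟨a, ha⟩ := Set.nonempty_iff_ne_empty.mpr h
      obtain ⟨b, hb, -⟩ := hAB a ha
      exact hb
    simp [this]
  have hA : A.Nonempty := by
    obtain ⟨b, hb⟩ := hB
    obtain ⟨a, ha, -⟩ := hBA b hb 1 one_pos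
    exact ⟨a, ha⟩
  by_cases hbd : BddBelow B
  · have hbdA : BddBelow A := by
      obtain ⟨m, hm⟩ := hbd
      refine ⟨2 * m, fun a ha => ?_⟩
      obtain ⟨b, hb, h⟩ := hAB a ha
      linarith [hm hb]
    apply le_antisymm
    · have : sInf A / 2 ≤ sInf B := by
        refine le_csInf hB fun b hb => ?_
        refine le_of_forall_pos_le_add fun ε hε => ?_
        obtain ⟨a, ha, h⟩ := hBA b hb ε hε
        linarith [csInf_le hbdA ha]
      linarith
    · refine le_csInf hA fun a ha => ?_
      obtain ⟨b, hb, h⟩ := hAB a ha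
      linarith [csInf_le hbd hb]
  · have hbdA : ¬ BddBelow A := by
      rintro ⟨m, hm⟩
      refine hbd ⟨(m - 1) / 2, fun b hb => ?_⟩
      obtain ⟨a, ha, h⟩ := hBA b hb 1 one_pos
      linarith [hm ha]
    rw [Real.sInf_of_not_bddBelow hbd, Real.sInf_of_not_bddBelow hbdA, mul_zero]

/-! ### Integrals over the line and the half-line -/

lemma integrable_comp_abs_of_integrableOn_Ioi {f : ℝ → ℝ} (hf : IntegrableOn f (Ioi 0)) :
    Integrable fun x => f |x| := by
  have h := (integrable_indicator_iff measurableSet_Ioi).mpr hf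
  refine (h.add h.comp_neg).congr ?_
  filter_upwards [Measure.ae_ne volume (0 : ℝ)] with x hx
  rcases lt_or_gt_of_ne hx with h | h
  · simp [indicator, h, abs_of_neg h, not_lt.mpr h.le]
  · simp [indicator, h, abs_of_pos h, not_lt.mpr h.le]

lemma integral_eq_integral_Ioi_add_integral_Ioi {f : ℝ → ℝ} (hf : Integrable f) (a : ℝ) :
    ∫ x, f x = (∫ x in Ioi 0, f (a + x)) + ∫ x in Ioi 0, f (a - x) := by
  have hg : Integrable fun x => f (a + x) := hf.comp_add_left a
  have h := integral_comp_neg_Ioi 0 fun x => f (a + x)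
  simp only [← sub_eq_add_neg, neg_zero] at h
  rw [h, add_comm, intervalIntegral.integral_Iic_add_Ioi hg.integrableOn hg.integrableOn,
    integral_add_left_eq_self f a]

lemma exists_integral_Ioi_eq {f : ℝ → ℝ} (hf : Integrable f) (hpos : 0 < ∫ x, f x) :
    ∃ a, (∫ x in Ioi 0, f (a + x)) = (∫ x, f x) / 2 ∧
      (∫ x in Ioi 0, f (a - x)) = (∫ x, f x) / 2 := by
  have hsplit := integral_eq_integral_Ioi_add_integral_Ioi hf
  have h0 := hsplit 0
  simp only [zero_add, zero_sub] at h0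
  set R := ∫ x in Ioi 0, f x with hR
  have hN := integral_comp_neg_Ioi 0 f
  rw [neg_zero] at hN
  set L := ∫ x in Ioi 0, f (-x) with hL
  have hcont : Continuous fun a => ∫ x in (0 : ℝ)..a, f x :=
    intervalIntegral.continuous_primitive (fun a b => hf.intervalIntegrable) 0
  have htop : Tendsto (fun a => ∫ x in (0 : ℝ)..a, f x) atTop (nhds R) :=
    intervalIntegral_tendsto_integral_Ioi 0 hf.integrableOn tendsto_id
  have hbot : Tendsto (fun a => ∫ x in (0 : ℝ)..a, f x) atBot (nhds (-L)) := by
    have := (intervalIntegral_tendsto_integral_Iic 0 hf.integrableOn tendsto_id).neg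
    rw [hN]
    refine this.congr fun a => ?_
    rw [← intervalIntegral.integral_symm, id]
  obtain ⟨b, hb⟩ := (hbot.eventually_le_const (u := (R - L) / 2) (by linarith)).exists
  obtain ⟨c, hc⟩ := (htop.eventually_const_le (u := (R - L) / 2) (by linarith)).exists
  obtain ⟨a, ha⟩ := mem_range_of_exists_le_of_exists_ge hcont ⟨b, hb⟩ ⟨c, hc⟩
  have key : (∫ x in Ioi 0, f (a - x)) = L + ∫ x in (0 : ℝ)..a, f x := by
    have h1 := integral_comp_neg_Ioi 0 fun x => f (a + x)
    simp only [← sub_eq_add_neg, neg_zero] at h1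
    have hmp := (measurePreserving_add_left volume a).setIntegral_preimage_emb
      (measurableEmbedding_addLeft a) f (Iic a)
    simp only [preimage_const_add_Iic, sub_self] at hmp
    rw [h1, hmp, hN, ← intervalIntegral.integral_Iic_sub_Iic hf.integrableOn hf.integrableOn]
    ring
  refine ⟨a, ?_, ?_⟩ <;> linarith [hsplit a]

lemma integral_mul_sub_mul_sub_mul {μ : Measure ℝ} {f g h : ℝ → ℝ} (hf : Integrable f μ)
    (hg : Integrable g μ) (hh : Integrable h μ) (a b c : ℝ) :
    ∫ x, (a * f x - b * g x - c * h x) ∂μ =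
      a * (∫ x, f x ∂μ) - b * (∫ x, g x ∂μ) - c * ∫ x, h x ∂μ := by
  have hfg : Integrable (fun x => a * f x - b * g x) μ := (hf.const_mul a).sub (hg.const_mul b)
  rw [integral_sub hfg (hh.const_mul c), integral_sub (hf.const_mul a) (hg.const_mul b)]
  simp only [integral_const_mul]

/-! ### Integrability of the energy density -/

lemma integrable_abs_rpow_of_bound {μ : Measure ℝ} {u : ℝ → ℝ} {B q : ℝ} (hq : 2 < q)
    (hu : AEStronglyMeasurable u μ) (hu2 : Integrable (fun x => u x ^ 2) μ)
    (hB : ∀ᵐ x ∂μ, |u x| ≤ B) : Integrable (fun x => |u x| ^ q) μ := by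
  refine (hu2.const_mul (B ^ (q - 2))).mono'
    (hu.norm.aemeasurable.pow_const q).aestronglyMeasurable ?_
  filter_upwards [hB] with x hx
  rw [Real.norm_of_nonneg (by positivity), ← sq_abs]
  calc |u x| ^ q = |u x| ^ (q - 2) * |u x| ^ 2 := by
        rw [← Real.rpow_natCast, ← Real.rpow_add' (abs_nonneg _)] <;> norm_num; linarith
    _ ≤ B ^ (q - 2) * |u x| ^ 2 := by
        gcongr

lemma integrable_abs_pow_six_of_bound {μ : Measure ℝ} {u : ℝ → ℝ} {B : ℝ}
    (hu : AEStronglyMeasurable u μ) (hu2 : Integrable (fun x => u x ^ 2) μ)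
    (hB : ∀ᵐ x ∂μ, |u x| ≤ B) : Integrable (fun x => |u x| ^ 6) μ := by
  simpa only [Real.rpow_ofNat] using
    integrable_abs_rpow_of_bound (q := 6) (by norm_num) hu hu2 hB

lemma H1halfline.aestronglyMeasurable {u u' : ℝ → ℝ} (h : H1halfline u u') :
    AEStronglyMeasurable u (volume.restrict (Ioi 0)) :=
  (h.1.mono Ioi_subset_Ici_self).aestronglyMeasurable measurableSet_Ioi

lemma H1halfline.aestronglyMeasurable_deriv {u u' : ℝ → ℝ} (h : H1halfline u u') :
    AEStronglyMeasurable u' (volume.restrict (Ioi 0)) :=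
  (measurable_deriv u).aestronglyMeasurable.congr <|
    (ae_restrict_iff' measurableSet_Ioi).mpr <| .of_forall fun x hx => (h.2.1 x hx).deriv

lemma H1halfline.exists_bound {u u' : ℝ → ℝ} (h : H1halfline u u') :
    ∃ B, 0 ≤ B ∧ ∀ x ∈ Ioi (0 : ℝ), |u x| ≤ B := by
  have hm := h.aestronglyMeasurable
  have hm' := h.aestronglyMeasurable_deriv
  obtain ⟨hc, hd, hu, hu'⟩ := h
  have hsum : IntegrableOn (fun x => u x ^ 2 + u' x ^ 2) (Ioi 0) := hu.add hu'
  have hle : ∀ x, ‖2 * u x * u' x‖ ≤ u x ^ 2 + u' x ^ 2 := fun x => by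
    rw [Real.norm_eq_abs, abs_le]
    constructor <;> nlinarith [sq_nonneg (u x + u' x), sq_nonneg (u x - u' x)]
  have hprod : IntegrableOn (fun x => 2 * u x * u' x) (Ioi 0) :=
    hsum.mono' ((hm.const_mul 2).mul hm') (.of_forall hle)
  set C := u 0 ^ 2 + ∫ x in Ioi 0, (u x ^ 2 + u' x ^ 2) with hC
  refine ⟨√C, Real.sqrt_nonneg _, fun x hx => Real.abs_le_sqrt ?_⟩
  have hx0 : (0 : ℝ) ≤ x := le_of_lt hx
  have hftc := intervalIntegral.integral_eq_sub_of_hasDerivAt_of_le (f := fun x => u x ^ 2)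
    (f' := fun x => 2 * u x * u' x) hx0 ((hc.mono Icc_subset_Ici_self).pow 2)
    (fun y hy => by simpa using (hd y hy.1).fun_pow 2)
    ((intervalIntegrable_iff_integrableOn_Ioc_of_le hx0).mpr (hprod.mono_set Ioc_subset_Ioi_self))
  rw [intervalIntegral.integral_of_le hx0] at hftc
  have h1 : ∫ y in Ioc 0 x, 2 * u y * u' y ≤ ∫ y in Ioc 0 x, (u y ^ 2 + u' y ^ 2) :=
    setIntegral_mono (hprod.mono_set Ioc_subset_Ioi_self) (hsum.mono_set Ioc_subset_Ioi_self)
      fun y => (le_abs_self _).trans (hle y)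
  have h2 : ∫ y in Ioc 0 x, (u y ^ 2 + u' y ^ 2) ≤ ∫ y in Ioi 0, (u y ^ 2 + u' y ^ 2) :=
    setIntegral_mono_set hsum (.of_forall fun y => by positivity)
      Ioc_subset_Ioi_self.eventuallyLE
  linarith

lemma H1line.continuous {u u' : ℝ → ℝ} (h : H1line u u') : Continuous u :=
  continuous_iff_continuousAt.mpr fun x => (h.1 x).continuousAt

lemma H1line.comp_const_add {u u' : ℝ → ℝ} (h : H1line u u') (a : ℝ) :
    H1halfline (fun x => u (a + x)) fun x => u' (a + x) :=
  ⟨(h.continuous.comp (continuous_const.add continuous_id)).continuousOn,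
    fun x _ => (h.1 (a + x)).comp_const_add a x,
    (h.2.1.comp_add_left a).integrableOn, (h.2.2.comp_add_left a).integrableOn⟩

lemma H1line.comp_const_sub {u u' : ℝ → ℝ} (h : H1line u u') (a : ℝ) :
    H1halfline (fun x => u (a - x)) fun x => -u' (a - x) :=
  ⟨(h.continuous.comp (continuous_const.sub continuous_id)).continuousOn,
    fun x _ => (h.1 (a - x)).comp_const_sub a x,
    (h.2.1.comp_sub_left a).integrableOn, by simpa using (h.2.2.comp_sub_left a).integrableOn⟩

lemma H1line.exists_bound {u u' : ℝ → ℝ} (h : H1line u u') : ∃ B, ∀ x, |u x| ≤ B := by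
  obtain ⟨B, hB, h1⟩ := (h.comp_const_add 0).exists_bound
  obtain ⟨C, hC, h2⟩ := (h.comp_const_sub 0).exists_bound
  refine ⟨B + C + |u 0|, fun x => ?_⟩
  have h0 := abs_nonneg (u 0)
  rcases lt_trichotomy x 0 with hx | rfl | hx
  · have := h2 (-x) (neg_pos.mpr hx)
    simp only [zero_sub, neg_neg] at this
    linarith
  · linarith
  · have := h1 x hx
    simp only [zero_add] at this
    linarith

lemma H1line.integrable_energy {u u' : ℝ → ℝ} {p : ℝ} (h : H1line u u') (hp : 2 < p) (α : ℝ) :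
    Integrable fun x => 1 / 2 * (u' x) ^ 2 - 1 / 6 * |u x| ^ 6 - α / p * |u x| ^ p := by
  obtain ⟨B, hB⟩ := h.exists_bound
  have hm := h.continuous.aestronglyMeasurable (μ := volume)
  exact ((h.2.2.const_mul _).sub
    ((integrable_abs_pow_six_of_bound hm h.2.1 (.of_forall hB)).const_mul _)).sub
    ((integrable_abs_rpow_of_bound hp hm h.2.1 (.of_forall hB)).const_mul _)

/-- Cutting a line function at the point which halves its mass, one of the two halves carries at
most half of the energy. -/
lemma H1line.exists_halfline {u u' : ℝ → ℝ} {p μ : ℝ} (h : H1line u u') (hp : 2 < p) (α : ℝ)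
    (hμ : 0 < μ) (hmass : ∫ x, (u x) ^ 2 = 2 * μ) :
    ∃ v v' : ℝ → ℝ, H1halfline v v' ∧ (∫ x in Ioi (0 : ℝ), (v x) ^ 2) = μ ∧
      2 * Ehalfline p α v v' ≤ Eline p α u u' := by
  obtain ⟨a, ha, ha'⟩ := exists_integral_Ioi_eq h.2.1 (by rw [hmass]; positivity)
  rw [hmass, mul_div_cancel_left₀ _ two_ne_zero] at ha ha'
  have hE : Eline p α u u' = Ehalfline p α (fun x => u (a + x)) (fun x => u' (a + x)) +
      Ehalfline p α (fun x => u (a - x)) (fun x => -u' (a - x)) := by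
    simpa only [Eline, Ehalfline, neg_sq] using
      integral_eq_integral_Ioi_add_integral_Ioi (h.integrable_energy hp α) a
  rcases le_total (Ehalfline p α (fun x => u (a + x)) (fun x => u' (a + x)))
    (Ehalfline p α (fun x => u (a - x)) (fun x => -u' (a - x))) with hle | hle
  · exact ⟨_, _, h.comp_const_add a, ha, by linarith⟩
  · exact ⟨_, _, h.comp_const_sub a, ha', by linarith⟩

/-! ### Flattening a half-line function near the origin -/

lemma exists_mul_lt_of_integrableOn_Ioi {f : ℝ → ℝ} (hf : IntegrableOn f (Ioi 0)) {η : ℝ}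
    (hη : 0 < η) : ∃ δ, 0 < δ ∧ δ < η ∧ δ * f δ < η := by
  by_contra! h
  have hinv : IntegrableOn (fun x : ℝ => x⁻¹) (Ioo 0 η) := by
    refine ((hf.mono_set Ioo_subset_Ioi_self).const_mul η⁻¹).mono'
      measurable_inv.aestronglyMeasurable ?_
    filter_upwards [ae_restrict_mem measurableSet_Ioo] with x hx
    have hx0 : 0 < x := hx.1
    rw [Real.norm_of_nonneg (by positivity), inv_mul_eq_div, le_div_iff₀ hη,
      inv_mul_le_iff₀ hx0]
    exact h x hx.1 hx.2
  have := (intervalIntegrable_iff_integrableOn_Ioo_of_le hη.le).mpr hinv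
  rw [intervalIntegrable_inv_iff] at this
  rcases this with h0 | h0
  · exact hη.ne h0
  · exact h0 left_mem_uIcc

/-- The function `u` with its values on `(-∞, δ]` replaced by the even quadratic polynomial
which matches `u` to first order at `δ`. -/
noncomputable def flatten (u u' : ℝ → ℝ) (δ x : ℝ) : ℝ :=
  if x ≤ δ then u δ - u' δ * δ / 2 + u' δ / (2 * δ) * x ^ 2 else u x

/-- The derivative of `flatten u u' δ`. -/
noncomputable def flattenDeriv (u' : ℝ → ℝ) (δ x : ℝ) : ℝ :=
  if x ≤ δ then u' δ / δ * x else u' x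

lemma hasDerivAt_flatten {u u' : ℝ → ℝ} {δ : ℝ} (hδ : 0 < δ)
    (hd : ∀ x ∈ Ioi (0 : ℝ), HasDerivAt u (u' x) x) (x : ℝ) :
    HasDerivAt (flatten u u' δ) (flattenDeriv u' δ x) x := by
  have hquad : ∀ y, HasDerivAt (fun x => u δ - u' δ * δ / 2 + u' δ / (2 * δ) * x ^ 2)
      (u' δ / δ * y) y := fun y => by
    convert! (((hasDerivAt_id y).fun_pow 2).const_mul (u' δ / (2 * δ))).const_add
      (u δ - u' δ * δ / 2) using 1
    simp
    field_simp
  rcases lt_trichotomy x δ with hx | rfl | hx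
  · rw [flattenDeriv, if_pos hx.le]
    refine (hquad x).congr_of_eventuallyEq ?_
    filter_upwards [Iio_mem_nhds hx] with y hy
    exact if_pos (le_of_lt hy)
  · have hval : u x - u' x * x / 2 + u' x / (2 * x) * x ^ 2 = u x := by
      field_simp
      ring
    have hl : HasDerivWithinAt (flatten u u' x) (u' x) (Iic x) x := by
      have := (hquad x).hasDerivWithinAt (s := Iic x)
      rw [div_mul_cancel₀ _ hδ.ne'] at this
      exact this.congr (fun y hy => if_pos hy) (if_pos le_rfl)
    have hr : HasDerivWithinAt (flatten u u' x) (u' x) (Ici x) x := by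
      refine (hd x hδ).hasDerivWithinAt.congr (fun y hy => ?_) ?_
      · rcases eq_or_lt_of_le (show x ≤ y from hy) with rfl | hy
        · rw [flatten, if_pos le_rfl, hval]
        · exact if_neg hy.not_ge
      · rw [flatten, if_pos le_rfl, hval]
    have := hl.union hr
    rw [Iic_union_Ici, hasDerivWithinAt_univ] at this
    rwa [flattenDeriv, if_pos le_rfl, div_mul_cancel₀ _ hδ.ne']
  · rw [flattenDeriv, if_neg hx.not_ge]
    refine (hd x (hδ.trans hx)).congr_of_eventuallyEq ?_
    filter_upwards [Ioi_mem_nhds hx] with y hy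
    exact if_neg (not_le_of_gt hy)

lemma continuous_flatten {u u' : ℝ → ℝ} {δ : ℝ} (hδ : 0 < δ)
    (hd : ∀ x ∈ Ioi (0 : ℝ), HasDerivAt u (u' x) x) : Continuous (flatten u u' δ) :=
  continuous_iff_continuousAt.mpr fun x => (hasDerivAt_flatten hδ hd x).continuousAt

lemma measurable_flattenDeriv {u u' : ℝ → ℝ} {δ : ℝ} (hδ : 0 < δ)
    (hd : ∀ x ∈ Ioi (0 : ℝ), HasDerivAt u (u' x) x) : Measurable (flattenDeriv u' δ) := by
  have : flattenDeriv u' δ = deriv (flatten u u' δ) :=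
    funext fun x => (hasDerivAt_flatten hδ hd x).deriv.symm
  rw [this]
  exact measurable_deriv _

lemma abs_flatten_le {u u' : ℝ → ℝ} {δ x : ℝ} (hδ : 0 < δ) (hδ1 : δ ≤ 1)
    (hδu : δ * u' δ ^ 2 ≤ 1) (hx : 0 < x) (hxδ : x ≤ δ) :
    |flatten u u' δ x| ≤ |u δ| + 1 := by
  have hval : flatten u u' δ x = u δ - u' δ * δ / 2 * (1 - (x / δ) ^ 2) := by
    rw [flatten, if_pos hxδ]
    field_simp
    ring
  have h1 : |u' δ * δ| ≤ 1 := by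
    rw [← sq_le_one_iff_abs_le_one]
    nlinarith [sq_nonneg (u' δ)]
  have h2 : |1 - (x / δ) ^ 2| ≤ 1 := by
    have : x / δ ≤ 1 := (div_le_one hδ).mpr hxδ
    have : 0 < x / δ := by positivity
    rw [abs_le]
    constructor <;> nlinarith
  rw [hval]
  refine (abs_sub _ _).trans ?_
  rw [abs_mul, abs_div, abs_two]
  nlinarith [abs_nonneg (u' δ * δ), abs_nonneg (1 - (x / δ) ^ 2)]

lemma flattenDeriv_sq_le (u' : ℝ → ℝ) {δ x : ℝ} (hx : 0 < x) :
    flattenDeriv u' δ x ^ 2 ≤ u' x ^ 2 + (Ioc 0 δ).indicator (fun _ => u' δ ^ 2) x := by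
  by_cases hxδ : x ≤ δ
  · have hδ : 0 < δ := hx.trans_le hxδ
    rw [flattenDeriv, if_pos hxδ, indicator_of_mem (show x ∈ Ioc 0 δ from ⟨hx, hxδ⟩)]
    have h1 : x / δ ≤ 1 := (div_le_one hδ).mpr hxδ
    have h0 : 0 < x / δ := by positivity
    have : u' δ / δ * x = u' δ * (x / δ) := by ring
    rw [this, mul_pow]
    nlinarith [sq_nonneg (u' x), sq_nonneg (u' δ), pow_le_one₀ (n := 2) h0.le h1]
  · rw [flattenDeriv, if_neg hxδ, indicator_of_notMem (fun h => hxδ h.2), add_zero]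

lemma integrableOn_sq_flattenDeriv {u u' : ℝ → ℝ} {δ : ℝ} (hδ : 0 < δ) (h : H1halfline u u') :
    IntegrableOn (fun x => flattenDeriv u' δ x ^ 2) (Ioi 0) ∧
      ∫ x in Ioi 0, flattenDeriv u' δ x ^ 2 ≤ (∫ x in Ioi 0, u' x ^ 2) + δ * u' δ ^ 2 := by
  have hind : IntegrableOn ((Ioc 0 δ).indicator fun _ => u' δ ^ 2) (Ioi 0) :=
    (integrable_indicator_iff measurableSet_Ioc).mpr (by simp) |>.integrableOn
  have hle : ∀ᵐ x ∂volume.restrict (Ioi (0 : ℝ)), flattenDeriv u' δ x ^ 2 ≤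
      u' x ^ 2 + (Ioc 0 δ).indicator (fun _ => u' δ ^ 2) x := by
    filter_upwards [ae_restrict_mem measurableSet_Ioi] with x hx
    exact flattenDeriv_sq_le u' hx
  have hint : IntegrableOn (fun x => flattenDeriv u' δ x ^ 2) (Ioi 0) := by
    refine (h.2.2.2.add hind).mono'
      ((measurable_flattenDeriv hδ h.2.1).pow_const 2).aestronglyMeasurable ?_
    filter_upwards [hle] with x hx
    rwa [Real.norm_of_nonneg (sq_nonneg _)]
  refine ⟨hint, (integral_mono_ae hint (h.2.2.2.add hind) hle).trans_eq ?_⟩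
  simp only [Pi.add_apply]
  rw [integral_add h.2.2.2 hind, setIntegral_indicator measurableSet_Ioc,
    inter_eq_right.mpr Ioc_subset_Ioi_self]
  simp [hδ.le]

/-- Along `δ → 0`, the integral of a continuous function of `flatten u u' δ` converges to that of
the same function of `u`. -/
lemma tendsto_integral_flatten {u u' G : ℝ → ℝ} {δ : ℕ → ℝ} (h : H1halfline u u')
    (hG : Continuous G) (hGu : IntegrableOn (fun x => G (u x)) (Ioi 0)) (hδ0 : ∀ n, 0 < δ n)
    (hδ1 : ∀ n, δ n ≤ 1) (hδu : ∀ n, δ n * u' (δ n) ^ 2 ≤ 1) (hδ : Tendsto δ atTop (nhds 0)) :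
    (∀ n, IntegrableOn (fun x => G (flatten u u' (δ n) x)) (Ioi 0)) ∧
      Tendsto (fun n => ∫ x in Ioi 0, G (flatten u u' (δ n) x)) atTop
        (nhds (∫ x in Ioi 0, G (u x))) := by
  obtain ⟨B, hB, hu⟩ := h.exists_bound
  obtain ⟨C, hC⟩ := (isCompact_Icc (a := -(B + 1)) (b := B + 1)).exists_bound_of_continuousOn
    hG.continuousOn
  have hind : IntegrableOn ((Ioc (0 : ℝ) 1).indicator fun _ => C) (Ioi 0) :=
    (integrable_indicator_iff measurableSet_Ioc).mpr (by simp) |>.integrableOn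
  have hbound : IntegrableOn (fun x => ‖G (u x)‖ + (Ioc (0 : ℝ) 1).indicator (fun _ => C) x)
      (Ioi 0) := hGu.norm.add hind
  have hmeas : ∀ n, AEStronglyMeasurable (fun x => G (flatten u u' (δ n) x))
      (volume.restrict (Ioi 0)) := fun n =>
    (hG.comp (continuous_flatten (hδ0 n) h.2.1)).aestronglyMeasurable
  have hC0 : 0 ≤ C := (norm_nonneg _).trans (hC 0 ⟨by linarith, by linarith⟩)
  have hle : ∀ n, ∀ᵐ x ∂volume.restrict (Ioi (0 : ℝ)), ‖G (flatten u u' (δ n) x)‖ ≤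
      ‖G (u x)‖ + (Ioc (0 : ℝ) 1).indicator (fun _ => C) x := fun n => by
    filter_upwards [ae_restrict_mem measurableSet_Ioi] with x hx
    by_cases hxδ : x ≤ δ n
    · rw [indicator_of_mem (show x ∈ Ioc (0 : ℝ) 1 from ⟨hx, hxδ.trans (hδ1 n)⟩)]
      have h1 := abs_flatten_le (u := u) (hδ0 n) (hδ1 n) (hδu n) hx hxδ
      have h2 := hC (flatten u u' (δ n) x)
        (abs_le.mp (h1.trans (by linarith [hu (δ n) (hδ0 n)])))
      linarith [norm_nonneg (G (u x))]
    · rw [flatten, if_neg hxδ]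
      linarith [indicator_nonneg (s := Ioc (0 : ℝ) 1) (f := fun _ => C) (fun _ _ => hC0) x]
  refine ⟨fun n => hbound.mono' (hmeas n) (hle n),
    tendsto_integral_of_dominated_convergence _ hmeas hbound hle ?_⟩
  filter_upwards [ae_restrict_mem measurableSet_Ioi] with x hx
  refine tendsto_const_nhds.congr' ?_
  filter_upwards [hδ.eventually_lt_const (show (0 : ℝ) < x from hx)] with n hn
  rw [flatten, if_neg hn.not_ge]

/-! ### Even reflection -/

lemma HasDerivAt.comp_abs {v v' : ℝ → ℝ} (hv : ∀ x, HasDerivAt v (v' x) x) (h0 : v' 0 = 0)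
    (x : ℝ) : HasDerivAt (fun x => v |x|) (SignType.sign x * v' |x|) x := by
  rcases lt_trichotomy x 0 with hx | rfl | hx
  · simpa [hx, mul_comm, Function.comp_def] using (hv |x|).comp x (hasDerivAt_abs_neg hx)
  · have hr : HasDerivWithinAt (fun x => v |x|) 0 (Ici 0) 0 := by
      have := (hv 0).hasDerivWithinAt (s := Ici 0)
      rw [h0] at this
      exact this.congr (fun y (hy : 0 ≤ y) => by rw [abs_of_nonneg hy])
        (by simp)
    have hl : HasDerivWithinAt (fun x => v |x|) 0 (Iic 0) 0 := by
      have := (hv (-0)).comp 0 (hasDerivAt_neg 0)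
      simp only [neg_zero, h0, zero_mul] at this
      exact this.hasDerivWithinAt.congr (fun y (hy : y ≤ 0) => by simp [abs_of_nonpos hy])
        (by simp)
    have := hl.union hr
    rw [Iic_union_Ici, hasDerivWithinAt_univ] at this
    simpa using this
  · simpa [hx, mul_comm, Function.comp_def] using (hv |x|).comp x (hasDerivAt_abs_pos hx)

lemma sign_mul_sq {x : ℝ} (hx : x ≠ 0) (y : ℝ) : ((SignType.sign x : ℝ) * y) ^ 2 = y ^ 2 := by
  rcases lt_or_gt_of_ne hx with h | h <;> simp [h]

/-- The multiple by `c` of the even reflection of a half-line function with vanishing derivative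
at the origin is an `H¹` function on the line. -/
lemma exists_line_of_halfline {v v' : ℝ → ℝ} {p : ℝ} (α c : ℝ)
    (hv : ∀ x, HasDerivAt v (v' x) x) (h0 : v' 0 = 0)
    (hv2 : IntegrableOn (fun x => v x ^ 2) (Ioi 0))
    (hv2' : IntegrableOn (fun x => v' x ^ 2) (Ioi 0))
    (hv6 : IntegrableOn (fun x => |v x| ^ 6) (Ioi 0))
    (hvp : IntegrableOn (fun x => |v x| ^ p) (Ioi 0)) (hc : 0 ≤ c) :
    ∃ w w' : ℝ → ℝ, H1line w w' ∧ (∫ x, w x ^ 2) = 2 * (c ^ 2 * ∫ x in Ioi 0, v x ^ 2) ∧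
      Eline p α w w' = 2 * (1 / 2 * (c ^ 2 * ∫ x in Ioi 0, v' x ^ 2) -
        1 / 6 * (c ^ 6 * ∫ x in Ioi 0, |v x| ^ 6) -
        α / p * (c ^ p * ∫ x in Ioi 0, |v x| ^ p)) := by
  have hne : ∀ᵐ x : ℝ, x ≠ 0 := Measure.ae_ne volume 0
  refine ⟨fun x => c * v |x|, fun x => c * (SignType.sign x * v' |x|),
    ⟨fun x => (HasDerivAt.comp_abs hv h0 x).const_mul c, ?_, ?_⟩, ?_, ?_⟩
  · simpa only [mul_pow] using integrable_comp_abs_of_integrableOn_Ioi (hv2.const_mul (c ^ 2))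
  · refine (integrable_comp_abs_of_integrableOn_Ioi (hv2'.const_mul (c ^ 2))).congr ?_
    filter_upwards [hne] with x hx
    rw [mul_pow, sign_mul_sq hx]
  · simp only [mul_pow]
    rw [integral_comp_abs (f := fun x => c ^ 2 * v x ^ 2), integral_const_mul]
  · have hE : Eline p α (fun x => c * v |x|) (fun x => c * (SignType.sign x * v' |x|)) =
        ∫ x, (fun y => 1 / 2 * (c ^ 2 * v' y ^ 2) - 1 / 6 * (c ^ 6 * |v y| ^ 6) -
          α / p * (c ^ p * |v y| ^ p)) |x| := by
      refine integral_congr_ae ?_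
      filter_upwards [hne] with x hx
      rw [mul_pow, sign_mul_sq hx, abs_mul, abs_of_nonneg hc, mul_pow,
        Real.mul_rpow hc (abs_nonneg _)]
    rw [hE, integral_comp_abs (f := fun y => 1 / 2 * (c ^ 2 * v' y ^ 2) -
        1 / 6 * (c ^ 6 * |v y| ^ 6) - α / p * (c ^ p * |v y| ^ p)),
      integral_mul_sub_mul_sub_mul (hv2'.const_mul _) (hv6.const_mul _) (hvp.const_mul _)]
    simp only [integral_const_mul]

/-- Flattening at the origin, reflecting and restoring the mass turns a half-line function into a
line function of twice the mass and almost at most twice the energy. -/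
lemma H1halfline.exists_line {u u' : ℝ → ℝ} {p μ ε : ℝ} (h : H1halfline u u') (hp : 2 < p) (α : ℝ)
    (hμ : 0 < μ) (hmass : ∫ x in Ioi (0 : ℝ), (u x) ^ 2 = μ) (hε : 0 < ε) :
    ∃ w w' : ℝ → ℝ, H1line w w' ∧ (∫ x, (w x) ^ 2) = 2 * μ ∧
      Eline p α w w' ≤ 2 * Ehalfline p α u u' + ε := by
  choose δ hδ0 hδlt hδu using fun n : ℕ =>
    exists_mul_lt_of_integrableOn_Ioi h.2.2.2 (Nat.one_div_pos_of_nat (α := ℝ) (n := n))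
  have hn1 : ∀ n : ℕ, 1 / ((n : ℝ) + 1) ≤ 1 := fun n => by
    rw [div_le_one (by positivity)]
    linarith [n.cast_nonneg (α := ℝ)]
  have hδ1 : ∀ n, δ n ≤ 1 := fun n => (hδlt n).le.trans (hn1 n)
  have hδu1 : ∀ n, δ n * u' (δ n) ^ 2 ≤ 1 := fun n => (hδu n).le.trans (hn1 n)
  have hlim := tendsto_one_div_add_atTop_nhds_zero_nat (𝕜 := ℝ)
  have hδ : Tendsto δ atTop (nhds 0) :=
    squeeze_zero (fun n => (hδ0 n).le) (fun n => (hδlt n).le) hlim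
  have hδu' : Tendsto (fun n => δ n * u' (δ n) ^ 2) atTop (nhds 0) :=
    squeeze_zero (fun n => mul_nonneg (hδ0 n).le (sq_nonneg _)) (fun n => (hδu n).le) hlim
  obtain ⟨B, -, hB⟩ := h.exists_bound
  have hB' : ∀ᵐ x ∂volume.restrict (Ioi (0 : ℝ)), |u x| ≤ B :=
    (ae_restrict_iff' measurableSet_Ioi).mpr (.of_forall hB)
  have hu6 := integrable_abs_pow_six_of_bound h.aestronglyMeasurable h.2.2.1 hB'
  have hup := integrable_abs_rpow_of_bound hp h.aestronglyMeasurable h.2.2.1 hB'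
  obtain ⟨hI2, hM⟩ := tendsto_integral_flatten h (continuous_pow 2) h.2.2.1 hδ0 hδ1 hδu1 hδ
  obtain ⟨hI6, hS⟩ := tendsto_integral_flatten h (G := fun t => |t| ^ 6)
    (by fun_prop) hu6 hδ0 hδ1 hδu1 hδ
  obtain ⟨hIp, hP⟩ := tendsto_integral_flatten h
    (continuous_abs.rpow_const fun _ => .inr (by linarith)) hup hδ0 hδ1 hδu1 hδ
  have hK := fun n => integrableOn_sq_flattenDeriv (hδ0 n) h
  have hE : Ehalfline p α u u' = 1 / 2 * (∫ x in Ioi 0, u' x ^ 2) -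
      1 / 6 * (∫ x in Ioi 0, |u x| ^ 6) - α / p * ∫ x in Ioi 0, |u x| ^ p :=
    integral_mul_sub_mul_sub_mul h.2.2.2 hu6 hup _ _ _
  rw [hmass] at hM
  set M := fun n => ∫ x in Ioi 0, flatten u u' (δ n) x ^ 2 with hMdef
  have hc : Tendsto (fun n => √(μ / M n)) atTop (nhds 1) := by
    have := (tendsto_const_nhds.div hM hμ.ne').sqrt (f := fun n => μ / M n)
    rwa [div_self hμ.ne', Real.sqrt_one] at this
  have hlimE : Tendsto (fun n => 2 * (1 / 2 * (√(μ / M n) ^ 2 *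
      ((∫ x in Ioi 0, u' x ^ 2) + δ n * u' (δ n) ^ 2)) -
      1 / 6 * (√(μ / M n) ^ 6 * ∫ x in Ioi 0, |flatten u u' (δ n) x| ^ 6) -
      α / p * (√(μ / M n) ^ p * ∫ x in Ioi 0, |flatten u u' (δ n) x| ^ p))) atTop
      (nhds (2 * Ehalfline p α u u')) := by
    have h1 := (((hc.pow 2).mul (hδu'.const_add (∫ x in Ioi 0, u' x ^ 2))).const_mul (1 / 2))
    have h2 := ((hc.pow 6).mul hS).const_mul (1 / 6)
    have h3 := ((hc.rpow_const (p := p) (.inl one_ne_zero)).mul hP).const_mul (α / p)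
    have := ((h1.sub h2).sub h3).const_mul 2
    simpa only [one_pow, Real.one_rpow, one_mul, add_zero, ← hE] using this
  obtain ⟨n, hnE, hnM⟩ := ((hlimE.eventually_le_const (show _ < 2 * Ehalfline p α u u' + ε by
    linarith)).and (hM.eventually_const_lt hμ)).exists
  obtain ⟨w, w', hw, hwm, hwE⟩ := exists_line_of_halfline (p := p) α √(μ / M n)
    (hasDerivAt_flatten (hδ0 n) h.2.1) (by simp [flattenDeriv, (hδ0 n).le]) (hI2 n) (hK n).1
    (hI6 n) (hIp n) (Real.sqrt_nonneg _)
  refine ⟨w, w', hw, ?_, ?_⟩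
  · rw [hwm, Real.sq_sqrt (by positivity)]
    change 2 * (μ / M n * M n) = 2 * μ
    rw [div_mul_cancel₀ _ hnM.ne']
  · rw [hwE]
    refine le_trans ?_ hnE
    gcongr
    exact (hK n).2

/-- Doubling identity between the line and the half-line: for `p ∈ (2,6)`, `α > 0`
and `μ ∈ (0, μ_{ℝ⁺})`, one has `ℰ_α(2μ, ℝ) = 2 ℰ_α(μ, ℝ⁺)`. -/
theorem doubling_identity_line_halfline (p α μ : ℝ)
    (hp : 2 < p) (hp' : p < 6) (hα : 0 < α)
    (hμ : 0 < μ) (hμR : μ < Real.pi * Real.sqrt 3 / 4) :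
    glevelLine p α (2 * μ) = 2 * glevelHalfline p α μ := by
  refine sInf_eq_two_mul_sInf ?_ ?_
  · rintro _ ⟨u, u', h, hmass, rfl⟩
    obtain ⟨v, v', hv, hvm, hle⟩ := h.exists_halfline hp α hμ hmass
    exact ⟨_, ⟨v, v', hv, hvm, rfl⟩, hle⟩
  · rintro _ ⟨u, u', h, hmass, rfl⟩ ε hε
    obtain ⟨w, w', hw, hwm, hle⟩ := h.exists_line hp α hμ hmass hε
    exact ⟨_, ⟨w, w', hw, hwm, rfl⟩, hle⟩
end

section
/- Strict sub-homogeneity and strict monotonicity of the ground state level on the line: let p ∈ (2,6) and α > 0. For every μ > 0 and θ > 1 with θμ < μ_ℝ one has ℰ_α(θμ, ℝ) < θ ℰ_α(μ, ℝ); consequently, the map μ ↦ ℰ_α(μ, ℝ) is strictly decreasing on (0, μ_ℝ). -/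
open MeasureTheory Real Set Filter

namespace H1line

variable {u u' : ℝ → ℝ}

theorem measurable_fst (h : H1line u u') : Measurable u :=
  (continuous_iff_continuousAt.2 fun x => (h.1 x).continuousAt).measurable

theorem continuous_s14 (h : H1line u u') : Continuous u :=
  continuous_iff_continuousAt.2 fun x => (h.1 x).continuousAt

theorem measurable_deriv (h : H1line u u') : Measurable u' := by
  have : u' = deriv u := funext fun x => (h.1 x).deriv.symm
  rw [this]
  exact _root_.measurable_deriv u

theorem comp_mul_left (h : H1line u u') (c : ℝ) {k : ℝ} (hk : k ≠ 0) :
    H1line (fun x => c * u (k * x)) (fun x => c * k * u' (k * x)) := by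
  refine ⟨fun x => ?_, ?_, ?_⟩
  · have h1 : HasDerivAt (fun x => k * x) k x := by
      simpa using (hasDerivAt_id x).const_mul k
    exact (((h.1 (k * x)).comp x h1).const_mul c).congr_deriv (by ring)
  · simp_rw [mul_pow]
    exact (h.2.1.comp_mul_left' hk).const_mul _
  · simp_rw [mul_pow]
    exact (h.2.2.comp_mul_left' hk).const_mul _

theorem const_mul (h : H1line u u') (c : ℝ) :
    H1line (fun x => c * u x) (fun x => c * u' x) := by
  simpa using h.comp_mul_left c one_ne_zero

theorem integrable_mul_deriv (h : H1line u u') : Integrable (fun x => 2 * u x * u' x) := by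
  refine (h.2.1.add h.2.2).mono'
    ((h.measurable_fst.const_mul 2).mul h.measurable_deriv).aestronglyMeasurable ?_
  refine Eventually.of_forall fun x => ?_
  simp only [Pi.add_apply, Real.norm_eq_abs]
  rw [abs_le]
  constructor <;> nlinarith [sq_nonneg (u x + u' x), sq_nonneg (u x - u' x)]

theorem hasDerivAt_sq (h : H1line u u') (x : ℝ) :
    HasDerivAt (fun x => u x ^ 2) (2 * u x * u' x) x :=
  ((h.1 x).fun_pow 2).congr_deriv (by norm_num)

theorem tendsto_sq_atTop (h : H1line u u') : Tendsto (fun x => u x ^ 2) atTop (nhds 0) :=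
  tendsto_zero_of_hasDerivAt_of_integrableOn_Ioi (a := 0) (fun x _ => h.hasDerivAt_sq x)
    h.integrable_mul_deriv.integrableOn h.2.1.integrableOn

theorem tendsto_sq_atBot (h : H1line u u') : Tendsto (fun x => u x ^ 2) atBot (nhds 0) :=
  tendsto_zero_of_hasDerivAt_of_integrableOn_Iic (a := 0) (fun x _ => h.hasDerivAt_sq x)
    h.integrable_mul_deriv.integrableOn h.2.1.integrableOn

theorem exists_forall_sq_le (h : H1line u u') : ∃ x₀, ∀ y, u y ^ 2 ≤ u x₀ ^ 2 := by
  by_cases h0 : ∀ x, u x = 0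
  · exact ⟨0, fun y => by simp [h0]⟩
  · push Not at h0
    obtain ⟨x, hx⟩ := h0
    refine (h.continuous_s14.pow 2).exists_forall_ge' x ?_
    have hpos : 0 < u x ^ 2 := by positivity
    rw [cocompact_eq_atBot_atTop, eventually_sup]
    exact ⟨(h.tendsto_sq_atBot.eventually (gt_mem_nhds hpos)).mono fun _ => le_of_lt,
      (h.tendsto_sq_atTop.eventually (gt_mem_nhds hpos)).mono fun _ => le_of_lt⟩

theorem integrable_abs_rpow (h : H1line u u') {q : ℝ} (hq : 2 < q) :
    Integrable (fun x => |u x| ^ q) := by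
  obtain ⟨x₀, hx₀⟩ := h.exists_forall_sq_le
  refine (h.2.1.const_mul (|u x₀| ^ (q - 2))).mono'
    (h.measurable_fst.abs.pow_const q).aestronglyMeasurable ?_
  refine Eventually.of_forall fun x => ?_
  rw [Real.norm_of_nonneg (by positivity)]
  have h1 : |u x| ^ q = |u x| ^ (q - 2) * u x ^ 2 := by
    rw [← sq_abs (u x), ← Real.rpow_natCast, ← Real.rpow_add_of_nonneg (abs_nonneg _)
      (by linarith) (by norm_num)]
    congr 1
    push_cast
    ring
  rw [h1]
  exact mul_le_mul_of_nonneg_right (Real.rpow_le_rpow (abs_nonneg _) (sq_le_sq.1 (hx₀ x))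
    (by linarith)) (sq_nonneg _)

theorem integrable_abs_pow_six (h : H1line u u') : Integrable (fun x => |u x| ^ 6) := by
  have := h.integrable_abs_rpow (q := 6) (by norm_num)
  simpa using this.congr (Eventually.of_forall fun x => by
    show |u x| ^ (6 : ℝ) = |u x| ^ 6
    exact_mod_cast Real.rpow_natCast |u x| 6)

theorem Eline_eq (h : H1line u u') {p : ℝ} (hp : 2 < p) (α : ℝ) :
    Eline p α u u' = 1 / 2 * (∫ x, u' x ^ 2) - 1 / 6 * (∫ x, |u x| ^ 6)
      - α / p * ∫ x, |u x| ^ p := by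
  have h1 := h.2.2.const_mul (1 / 2)
  have h2 := h.integrable_abs_pow_six.const_mul (1 / 6)
  have h3 := (h.integrable_abs_rpow hp).const_mul (α / p)
  have h4 : Integrable fun x => 1 / 2 * u' x ^ 2 - 1 / 6 * |u x| ^ 6 := h1.sub h2
  unfold Eline
  rw [integral_sub h4 h3, integral_sub h1 h2, integral_const_mul, integral_const_mul,
    integral_const_mul]

end H1line

theorem integral_zero_one_sqrt_one_sub_sq : ∫ t in (0 : ℝ)..1, √(1 - t ^ 2) = π / 4 := by
  have hc : Continuous fun t : ℝ => √(1 - t ^ 2) := by fun_prop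
  have h1 := intervalIntegral.integral_add_adjacent_intervals
    (hc.intervalIntegrable (μ := volume) (-1) 0) (hc.intervalIntegrable (μ := volume) 0 1)
  rw [integral_sqrt_one_sub_sq] at h1
  have h2 := intervalIntegral.integral_comp_neg (a := 0) (b := 1) fun t : ℝ => √(1 - t ^ 2)
  simp only [neg_sq, neg_zero] at h2
  linarith

/-- The critical energy is nonnegative up to the critical mass. -/
theorem H1line.integral_abs_pow_six_le {u u' : ℝ → ℝ} (h : H1line u u')
    (hm : ∫ x, u x ^ 2 ≤ π * √3 / 2) :
    1 / 6 * (∫ x, |u x| ^ 6) ≤ 1 / 2 * ∫ x, u' x ^ 2 := by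
  obtain ⟨x₀, hx₀⟩ := h.exists_forall_sq_le
  set M := u x₀ ^ 2 with hM
  by_cases hM0 : M = 0
  · have hu : ∀ x, u x = 0 := fun x => by
      have := hx₀ x
      rw [hM0] at this
      exact pow_eq_zero_iff (two_ne_zero) |>.1 (le_antisymm this (sq_nonneg _))
    simp only [hu]
    have : 0 ≤ ∫ x, u' x ^ 2 := integral_nonneg fun x => sq_nonneg _
    simp
    linarith
  have hMpos : 0 < M := lt_of_le_of_ne (sq_nonneg _) (Ne.symm hM0)
  have hs3 : √3 ^ 2 = (3 : ℝ) := Real.sq_sqrt (by norm_num)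
  have hc : Continuous fun t : ℝ => √(1 - t ^ 2) := by fun_prop
  set Φ : ℝ → ℝ := fun y => ∫ t in (0 : ℝ)..y, √(1 - t ^ 2) with hΦ
  have hΦd : ∀ y, HasDerivAt Φ (√(1 - y ^ 2)) y := fun y => hc.integral_hasStrictDerivAt 0 y
    |>.hasDerivAt
  set g : ℝ → ℝ := fun x => M ^ 2 / (2 * √3) * Φ (u x ^ 2 / M) with hg
  set g' : ℝ → ℝ := fun x =>
    M ^ 2 / (2 * √3) * (√(1 - (u x ^ 2 / M) ^ 2) * (2 * u x * u' x / M)) with hg'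
  have hgd : ∀ x, HasDerivAt g (g' x) x := fun x =>
    ((hΦd _).comp x ((h.hasDerivAt_sq x).div_const M)).const_mul _
  set L : ℝ → ℝ := fun x => 1 / 2 * u' x ^ 2 + M ^ 2 / 6 * u x ^ 2 - 1 / 6 * |u x| ^ 6 with hL
  have hLi : Integrable L :=
    ((h.2.2.const_mul _).add (h.2.1.const_mul _)).sub (h.integrable_abs_pow_six.const_mul _)
  have hbound : ∀ x, |g' x| ≤ L x := by
    intro x
    have hle : u x ^ 2 / M ≤ 1 := (div_le_one hMpos).2 (hx₀ x)
    have hr : 0 ≤ 1 - (u x ^ 2 / M) ^ 2 := by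
      have : 0 ≤ u x ^ 2 / M := by positivity
      nlinarith
    set r := √(1 - (u x ^ 2 / M) ^ 2) with hrdef
    have hr2 : r ^ 2 = 1 - (u x ^ 2 / M) ^ 2 := Real.sq_sqrt hr
    have h6 : |u x| ^ 6 = u x ^ 6 := by
      rw [show 6 = 2 * 3 by norm_num, pow_mul, pow_mul, sq_abs]
    set a := M * r * u x / √3 with ha
    have ha2 : a ^ 2 = M ^ 2 / 3 * u x ^ 2 - u x ^ 6 / 3 := by
      rw [ha, div_pow, hs3, mul_pow, mul_pow, hr2]
      field_simp
    have hga : g' x = a * u' x := by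
      simp only [hg', ha, ← hrdef]
      field_simp
    have hLa : L x = 1 / 2 * u' x ^ 2 + 1 / 2 * a ^ 2 := by
      simp only [hL, h6, ha2]
      ring
    rw [hga, hLa, abs_le]
    constructor <;> nlinarith [sq_nonneg (a + u' x), sq_nonneg (a - u' x)]
  have hg'm : Measurable g' := by
    have := h.measurable_fst
    have := h.measurable_deriv
    simp only [hg']
    fun_prop
  have hg'i : Integrable g' := hLi.mono' hg'm.aestronglyMeasurable
    (Eventually.of_forall hbound)
  have hΦc : Continuous Φ := continuous_iff_continuousAt.2 fun y => (hΦd y).continuousAt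
  have hlim : ∀ l : Filter ℝ, Tendsto (fun x => u x ^ 2) l (nhds 0) → Tendsto g l (nhds 0) := by
    intro l hl
    have h1 : Tendsto (fun x => Φ (u x ^ 2 / M)) l (nhds (Φ (0 / M))) :=
      (hΦc.tendsto _).comp (hl.div_const M)
    have h2 := h1.const_mul (M ^ 2 / (2 * √3))
    simpa [hΦ] using h2
  have hI := integral_Ioi_of_hasDerivAt_of_tendsto' (a := x₀) (fun x _ => hgd x)
    hg'i.integrableOn (hlim _ h.tendsto_sq_atTop)
  have hJ := integral_Iic_of_hasDerivAt_of_tendsto' (a := x₀) (fun x _ => hgd x)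
    hg'i.integrableOn (hlim _ h.tendsto_sq_atBot)
  have hgx : g x₀ = M ^ 2 / (2 * √3) * (π / 4) := by
    simp only [hg, hΦ, ← hM, div_self hM0, integral_zero_one_sqrt_one_sub_sq]
  have hLI : -(∫ x in Ioi x₀, g' x) ≤ ∫ x in Ioi x₀, L x := by
    rw [← integral_neg]
    exact setIntegral_mono hg'i.integrableOn.neg hLi.integrableOn
      fun x => (neg_le_abs _).trans (hbound x)
  have hLJ : (∫ x in Iic x₀, g' x) ≤ ∫ x in Iic x₀, L x :=
    setIntegral_mono hg'i.integrableOn hLi.integrableOn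
      fun x => (le_abs_self _).trans (hbound x)
  have hsplit := intervalIntegral.integral_Iic_add_Ioi hLi.integrableOn hLi.integrableOn
    (b := x₀)
  have hLeq : ∫ x, L x = 1 / 2 * (∫ x, u' x ^ 2) + M ^ 2 / 6 * (∫ x, u x ^ 2)
      - 1 / 6 * ∫ x, |u x| ^ 6 := by
    have h1 : Integrable fun x => 1 / 2 * u' x ^ 2 + M ^ 2 / 6 * u x ^ 2 :=
      (h.2.2.const_mul _).add (h.2.1.const_mul _)
    simp only [hL]
    rw [integral_sub h1 (h.integrable_abs_pow_six.const_mul _), integral_add (h.2.2.const_mul _)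
      (h.2.1.const_mul _), integral_const_mul, integral_const_mul, integral_const_mul]
  have hmass : M ^ 2 / 6 * (∫ x, u x ^ 2) ≤ M ^ 2 / 6 * (π * √3 / 2) := by gcongr
  have hconst : M ^ 2 / 6 * (π * √3 / 2) = 2 * (M ^ 2 / (2 * √3) * (π / 4)) := by
    field_simp
    rw [hs3]
    ring
  linarith

/-- The set of energies of functions of mass `μ`. -/
def energySet (p α μ : ℝ) : Set ℝ :=
  {e : ℝ | ∃ u u' : ℝ → ℝ, H1line u u' ∧ (∫ x, (u x) ^ 2) = μ ∧ Eline p α u u' = e}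

theorem exists_abs_rpow_le {p ε : ℝ} (hp : 2 < p) (hp' : p < 6) (hε : 0 < ε) :
    ∃ C, ∀ s : ℝ, |s| ^ p ≤ ε * |s| ^ 6 + C * s ^ 2 := by
  set R : ℝ := ε⁻¹ ^ (6 - p)⁻¹ with hR
  have hRpos : 0 < R := by positivity
  refine ⟨R ^ (p - 2), fun s => ?_⟩
  rcases eq_or_ne s 0 with rfl | hs
  · simp [Real.zero_rpow (by linarith : p ≠ 0)]
  have hs' : 0 < |s| := abs_pos.2 hs
  rcases le_total |s| R with h | h
  · have h1 : |s| ^ p = |s| ^ (p - 2) * s ^ 2 := by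
      rw [← sq_abs s, ← Real.rpow_natCast, ← Real.rpow_add hs']
      congr 1
      push_cast
      ring
    have h2 : |s| ^ (p - 2) * s ^ 2 ≤ R ^ (p - 2) * s ^ 2 := by
      gcongr
    have : 0 ≤ ε * |s| ^ 6 := by positivity
    linarith
  · have h1 : |s| ^ 6 = |s| ^ (6 - p) * |s| ^ p := by
      rw [← Real.rpow_natCast, ← Real.rpow_add hs']
      congr 1
      push_cast
      ring
    have h2 : ε⁻¹ ≤ |s| ^ (6 - p) := by
      have : R ^ (6 - p) ≤ |s| ^ (6 - p) := by
        gcongr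
      rwa [hR, Real.rpow_inv_rpow (by positivity) (by linarith)] at this
    have h3 : 1 ≤ ε * |s| ^ (6 - p) := by
      rwa [inv_le_iff_one_le_mul₀' hε] at h2
    have h4 : 0 < |s| ^ p := by positivity
    have h5 : 0 ≤ R ^ (p - 2) * s ^ 2 := by positivity
    rw [h1]
    nlinarith

theorem bddBelow_energySet {p α μ : ℝ} (hp : 2 < p) (hp' : p < 6) (hα : 0 < α) (hμ : 0 < μ)
    (hμ' : μ < π * √3 / 2) : BddBelow (energySet p α μ) := by
  set τ := π * √3 / 2 / μ with hτ
  have hτ1 : 1 < τ := (one_lt_div hμ).2 hμ'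
  have hτ2 : 0 < τ ^ 2 - 1 := by nlinarith
  obtain ⟨C, hC⟩ := exists_abs_rpow_le hp hp'
    (show 0 < p / α * ((τ ^ 2 - 1) / 6) by positivity)
  refine ⟨-(α / p * C * μ), ?_⟩
  rintro e ⟨u, u', h, hmass, rfl⟩
  rw [h.Eline_eq hp]
  have hsc := (h.const_mul (√τ)).integral_abs_pow_six_le (by
    simp_rw [mul_pow]
    rw [integral_const_mul, Real.sq_sqrt (by linarith), hmass, hτ, div_mul_cancel₀ _ hμ.ne'])
  have e6 : ∀ x, |√τ * u x| ^ 6 = τ ^ 3 * |u x| ^ 6 := fun x => by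
    rw [abs_mul, mul_pow, abs_of_nonneg (Real.sqrt_nonneg _), show 6 = 2 * 3 by norm_num, pow_mul,
      Real.sq_sqrt (by linarith)]
  have e2 : ∀ x, (√τ * u' x) ^ 2 = τ * u' x ^ 2 := fun x => by
    rw [mul_pow, Real.sq_sqrt (by linarith)]
  simp_rw [e6, e2, integral_const_mul] at hsc
  have hsc' : τ ^ 2 / 6 * (∫ x, |u x| ^ 6) ≤ 1 / 2 * ∫ x, u' x ^ 2 := by
    refine le_of_mul_le_mul_left ?_ (show 0 < τ by linarith)
    linarith
  have hpint : ∫ x, |u x| ^ p ≤ p / α * ((τ ^ 2 - 1) / 6) * (∫ x, |u x| ^ 6) + C * μ := by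
    rw [← hmass, ← integral_const_mul, ← integral_const_mul, ← integral_add
      (h.integrable_abs_pow_six.const_mul _) (h.2.1.const_mul _)]
    exact integral_mono (h.integrable_abs_rpow hp)
      ((h.integrable_abs_pow_six.const_mul _).add (h.2.1.const_mul _)) fun x => hC _
  have h1 : α / p * (∫ x, |u x| ^ p) ≤
      α / p * (p / α * ((τ ^ 2 - 1) / 6) * (∫ x, |u x| ^ 6) + C * μ) := by gcongr
  have h2 : α / p * (p / α * ((τ ^ 2 - 1) / 6) * (∫ x, |u x| ^ 6) + C * μ) =
      (τ ^ 2 - 1) / 6 * (∫ x, |u x| ^ 6) + α / p * C * μ := by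
    field_simp
  linarith

theorem H1line_gaussian :
    H1line (fun x => Real.exp (-x ^ 2)) (fun x => -(2 * x) * Real.exp (-x ^ 2)) := by
  refine ⟨fun x => ?_, ?_, ?_⟩
  · exact ((hasDerivAt_pow 2 x).fun_neg).exp.congr_deriv (by norm_num; ring)
  · have := integrable_exp_neg_mul_sq (b := 2) (by norm_num)
    refine this.congr (Eventually.of_forall fun x => ?_)
    simp only [← Real.exp_nat_mul]
    congr 1
    push_cast
    ring
  · have := (integrable_rpow_mul_exp_neg_mul_sq (b := 2) (by norm_num) (s := 2)
      (by norm_num)).const_mul 4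
    refine this.congr (Eventually.of_forall fun x => ?_)
    simp only [mul_pow, ← Real.exp_nat_mul, Real.rpow_two]
    rw [show -2 * x ^ 2 = ((2 : ℕ) : ℝ) * -x ^ 2 by push_cast; ring]
    ring

theorem integral_pos_of_forall_pos {f : ℝ → ℝ} (hf : Integrable f) (hpos : ∀ x, 0 < f x) :
    0 < ∫ x, f x := by
  rw [integral_pos_iff_support_of_nonneg (fun x => (hpos x).le) hf]
  have : Function.support f = univ := Set.eq_univ_of_forall fun x => (hpos x).ne'
  simp [this]

theorem exists_neg_mem_energySet {p α μ : ℝ} (hp : 2 < p) (hp' : p < 6) (hα : 0 < α)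
    (hμ : 0 < μ) : ∃ e ∈ energySet p α μ, e < 0 := by
  set G : ℝ → ℝ := fun x => Real.exp (-x ^ 2)
  have hm : 0 < ∫ x, G x ^ 2 :=
    integral_pos_of_forall_pos H1line_gaussian.2.1 fun x => by positivity
  set c := √(μ / ∫ x, G x ^ 2) with hc
  have hcpos : 0 < c := by positivity
  have hφ := H1line_gaussian.const_mul c
  set φ : ℝ → ℝ := fun x => c * Real.exp (-x ^ 2) with hφdef
  set φ' : ℝ → ℝ := fun x => c * (-(2 * x) * Real.exp (-x ^ 2))
  have hφpos : ∀ x, 0 < φ x := fun x => by positivity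
  have hmass : ∫ x, φ x ^ 2 = μ := by
    simp only [hφdef, mul_pow, integral_const_mul]
    rw [hc, Real.sq_sqrt (by positivity), div_mul_cancel₀ _ hm.ne']
  set K := ∫ x, φ' x ^ 2 with hK
  set B := ∫ x, |φ x| ^ p with hB
  have hBpos : 0 < B := integral_pos_of_forall_pos (hφ.integrable_abs_rpow hp) fun x =>
    Real.rpow_pos_of_pos (abs_pos.2 (hφpos x).ne') _
  have hlim : Tendsto (fun l : ℝ => 1 / 2 * K * l ^ (6 - p)) (nhds 0) (nhds 0) := by
    have h1 := (Real.continuousAt_rpow_const 0 (6 - p) (Or.inr (by linarith))).tendsto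
    rw [Real.zero_rpow (by linarith)] at h1
    simpa using h1.const_mul (1 / 2 * K)
  have hev : ∀ᶠ l in nhdsWithin (0 : ℝ) (Ioi 0), 1 / 2 * K * l ^ (6 - p) < α / p * B :=
    nhdsWithin_le_nhds (hlim.eventually (gt_mem_nhds (by positivity)))
  obtain ⟨l, hl, hl0⟩ := (hev.and self_mem_nhdsWithin).exists
  have hl0 : 0 < l := hl0
  have hv := hφ.comp_mul_left l (k := l ^ 2) (by positivity)
  have habs : |(l ^ 2)⁻¹| = (l ^ 2)⁻¹ := abs_of_pos (by positivity)
  refine ⟨_, ⟨_, _, hv, ?_, rfl⟩, ?_⟩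
  · simp only [mul_pow, integral_const_mul]
    rw [Measure.integral_comp_mul_left (fun x => φ x ^ 2) (l ^ 2), habs, hmass, smul_eq_mul]
    field_simp
  · rw [hv.Eline_eq hp]
    have h6 : 0 ≤ ∫ x, |l * φ (l ^ 2 * x)| ^ 6 := integral_nonneg fun x => by positivity
    have h2 : ∫ x, (l * l ^ 2 * φ' (l ^ 2 * x)) ^ 2 = l ^ 4 * K := by
      simp only [mul_pow, integral_const_mul]
      rw [Measure.integral_comp_mul_left (fun x => φ' x ^ 2) (l ^ 2), ← hK, habs, smul_eq_mul]
      field_simp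
    have hP : ∫ x, |l * φ (l ^ 2 * x)| ^ p = l ^ (p - 2) * B := by
      simp only [abs_mul, Real.mul_rpow (abs_nonneg _) (abs_nonneg _), integral_const_mul]
      rw [Measure.integral_comp_mul_left (fun x => |φ x| ^ p) (l ^ 2), ← hB, habs, smul_eq_mul,
        abs_of_pos hl0, Real.rpow_sub hl0, Real.rpow_two]
      field_simp
    have h4 : l ^ 4 = l ^ (p - 2) * l ^ (6 - p) := by
      rw [← Real.rpow_natCast, ← Real.rpow_add hl0]
      congr 1
      push_cast
      ring
    rw [h2, hP, h4]
    have hlp : 0 < l ^ (p - 2) := by positivity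
    nlinarith [mul_lt_mul_of_pos_left hl hlp]

theorem glevelLine_neg {p α μ : ℝ} (hp : 2 < p) (hp' : p < 6) (hα : 0 < α) (hμ : 0 < μ)
    (hμ' : μ < π * √3 / 2) : glevelLine p α μ < 0 := by
  obtain ⟨e, he, hneg⟩ := exists_neg_mem_energySet hp hp' hα hμ
  exact (csInf_le (bddBelow_energySet hp hp' hα hμ hμ') he).trans_lt hneg

theorem H1line.Eline_sqrt_mul_le {u u' : ℝ → ℝ} (h : H1line u u') {p α θ : ℝ} (hp : 2 < p)
    (hp' : p < 6) (hθ : 1 < θ) :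
    Eline p α (fun x => √θ * u x) (fun x => √θ * u' x) ≤ θ ^ (p / 2) * Eline p α u u' := by
  rw [(h.const_mul _).Eline_eq hp, h.Eline_eq hp]
  have hθ0 : 0 < θ := by linarith
  have e6 : ∀ x, |√θ * u x| ^ 6 = θ ^ 3 * |u x| ^ 6 := fun x => by
    rw [abs_mul, mul_pow, abs_of_nonneg (Real.sqrt_nonneg _), show 6 = 2 * 3 by norm_num, pow_mul,
      Real.sq_sqrt hθ0.le]
  have e2 : ∀ x, (√θ * u' x) ^ 2 = θ * u' x ^ 2 := fun x => by
    rw [mul_pow, Real.sq_sqrt hθ0.le]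
  have ep : ∀ x, |√θ * u x| ^ p = θ ^ (p / 2) * |u x| ^ p := fun x => by
    rw [abs_mul, Real.mul_rpow (abs_nonneg _) (abs_nonneg _), abs_of_nonneg (Real.sqrt_nonneg _),
      Real.sqrt_eq_rpow, ← Real.rpow_mul hθ0.le]
    congr 2
    ring
  simp_rw [e6, e2, ep, integral_const_mul]
  have h1 : θ ≤ θ ^ (p / 2) := Real.self_le_rpow_of_one_le hθ.le (by linarith)
  have h3 : θ ^ (p / 2) ≤ θ ^ 3 := by
    rw [← Real.rpow_natCast]
    exact Real.rpow_le_rpow_of_exponent_le hθ.le (by push_cast; linarith)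
  have hK : 0 ≤ ∫ x, u' x ^ 2 := integral_nonneg fun x => sq_nonneg _
  have hA : 0 ≤ ∫ x, |u x| ^ 6 := integral_nonneg fun x => by positivity
  nlinarith [mul_le_mul_of_nonneg_right h1 hK, mul_le_mul_of_nonneg_right h3 hA]

theorem glevelLine_mul_le {p α μ θ : ℝ} (hp : 2 < p) (hp' : p < 6) (hα : 0 < α) (hμ : 0 < μ)
    (hθ : 1 < θ) (hθμ : θ * μ < π * √3 / 2) :
    glevelLine p α (θ * μ) ≤ θ ^ (p / 2) * glevelLine p α μ := by
  have hθ0 : 0 < θ := by linarith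
  have hpow : 0 < θ ^ (p / 2) := by positivity
  rw [← div_le_iff₀' hpow]
  obtain ⟨e₀, he₀, -⟩ := exists_neg_mem_energySet hp hp' hα hμ
  refine le_csInf ⟨e₀, he₀⟩ ?_
  rintro e ⟨u, u', h, hmass, rfl⟩
  rw [div_le_iff₀' hpow]
  refine le_trans (csInf_le (bddBelow_energySet hp hp' hα (by positivity) hθμ)
    ⟨_, _, h.const_mul (√θ), ?_, rfl⟩) (h.Eline_sqrt_mul_le hp hp' hθ)
  simp_rw [mul_pow]
  rw [integral_const_mul, Real.sq_sqrt hθ0.le, hmass]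

theorem glevelLine_mul_lt {p α μ θ : ℝ} (hp : 2 < p) (hp' : p < 6) (hα : 0 < α) (hμ : 0 < μ)
    (hθ : 1 < θ) (hθμ : θ * μ < π * √3 / 2) :
    glevelLine p α (θ * μ) < θ * glevelLine p α μ := by
  refine (glevelLine_mul_le hp hp' hα hμ hθ hθμ).trans_lt ?_
  refine mul_lt_mul_of_neg_right (Real.self_lt_rpow_of_one_lt hθ (by linarith)) ?_
  exact glevelLine_neg hp hp' hα hμ (by nlinarith)

/-- Strict sub-homogeneity and strict monotonicity of the ground state level on the
line: for `p ∈ (2,6)` and `α > 0`, whenever `μ > 0`, `θ > 1` and `θμ < μ_ℝ` one has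
`ℰ_α(θμ, ℝ) < θ ℰ_α(μ, ℝ)`; consequently `μ ↦ ℰ_α(μ, ℝ)` is strictly decreasing
on `(0, μ_ℝ)`. -/
theorem glevel_subhomogeneous_strict_decreasing_line (p α : ℝ)
    (hp : 2 < p) (hp' : p < 6) (hα : 0 < α) :
    (∀ μ θ : ℝ, 0 < μ → 1 < θ → θ * μ < Real.pi * Real.sqrt 3 / 2 →
      glevelLine p α (θ * μ) < θ * glevelLine p α μ) ∧
    StrictAntiOn (glevelLine p α) (Set.Ioo 0 (Real.pi * Real.sqrt 3 / 2)) := by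
  refine ⟨fun μ θ hμ hθ hθμ => glevelLine_mul_lt hp hp' hα hμ hθ hθμ, ?_⟩
  intro a ha b hb hab
  have hθ : 1 < b / a := (one_lt_div ha.1).2 hab
  have hmul : b / a * a = b := div_mul_cancel₀ _ ha.1.ne'
  have h1 := glevelLine_mul_lt hp hp' hα ha.1 hθ (hmul.symm ▸ hb.2)
  rw [hmul] at h1
  have h2 := glevelLine_neg hp hp' hα ha.1 ha.2
  nlinarith
end
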